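/- arXiv:2210.11270 — 2 statements merged into one kernel-verified Lean document; each statement's English description precedes it below -/
import Mathlib

section
/- Let f : α → α be an FDS on a finite set α that has a fixpoint (there exists a ∈ α with f a = a). Then f is cancellative: for all FDSs g : β → β and h : γ → γ on finite sets, if f × g is isomorphic to f × h, then g is isomorphic to h. -/
/-- Two dynamical systems are isomorphic if there is a bijection commuting with the maps. -/
def FDSIso {α β : Type} (f : α → α) (g : β → β) : Prop :=
  ∃ e : α ≃ β, ∀ x, e (f x) = g (e x)

/-- The homomorphisms from the dynamical system `k` to the dynamical system `g`. -/
abbrev FDSHom {δ β : Type} (k : δ → δ) (g : β → β) : Type :=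
  {φ : δ → β // Function.Semiconj φ k g}

/-- The injective homomorphisms from `k` to `g`. -/
abbrev FDSEmb {δ β : Type} (k : δ → δ) (g : β → β) : Type :=
  {φ : FDSHom k g // Function.Injective φ.1}

/-- Homomorphisms into a product are pairs of homomorphisms. -/
def FDSHom.prodEquiv {δ α β : Type} (k : δ → δ) (f : α → α) (g : β → β) :
    FDSHom k (Prod.map f g) ≃ FDSHom k f × FDSHom k g where
  toFun φ := (⟨fun x => (φ.1 x).1, fun x => congrArg Prod.fst (φ.2 x)⟩,
    ⟨fun x => (φ.1 x).2, fun x => congrArg Prod.snd (φ.2 x)⟩)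
  invFun p := ⟨fun x => (p.1.1 x, p.2.1 x), fun x => Prod.ext (p.1.2 x) (p.2.2 x)⟩
  left_inv _ := rfl
  right_inv _ := rfl

/-- Isomorphic systems receive equally many homomorphisms. -/
theorem FDSIso.card_hom_eq {δ β γ : Type} (k : δ → δ) {g : β → β} {h : γ → γ}
    (H : FDSIso g h) : Nat.card (FDSHom k g) = Nat.card (FDSHom k h) := by
  obtain ⟨e, he⟩ := H
  refine Nat.card_congr ((Equiv.arrowCongr (Equiv.refl δ) e).subtypeEquiv fun φ => ?_)
  refine forall_congr' fun x => ?_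
  simp [← he]

/-- Homomorphisms whose kernel is the congruence `s` are the injective homomorphisms out of the
quotient by `s`. -/
def FDSHom.kerEquiv {δ β : Type} (k : δ → δ) (g : β → β) (s : Setoid δ)
    (hs : ∀ x y, s x y → s (k x) (k y)) :
    {φ : FDSHom k g // Setoid.ker φ.1 = s} ≃ FDSEmb (Quotient.map (sa := s) (sb := s) k hs) g where
  toFun φ := ⟨⟨fun q => Quotient.lift (s := s) φ.1.1
      (fun x y hxy => by
        have hxy : s x y := hxy
        rwa [← φ.2] at hxy) q,
      fun q => Quotient.inductionOn q fun x => φ.1.2 x⟩,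
    fun p q => Quotient.inductionOn₂ p q fun x y hxy => Quotient.sound (by
      change s x y
      rw [← φ.2]
      exact hxy)⟩
  invFun ψ := ⟨⟨fun x => ψ.1.1 (Quotient.mk s x), fun x => ψ.1.2 (Quotient.mk s x)⟩,
    Setoid.ext fun _ _ => ⟨fun hxy => Quotient.exact (ψ.2 hxy),
      fun hxy => congrArg ψ.1.1 (Quotient.sound hxy)⟩⟩
  left_inv _ := rfl
  right_inv ψ := Subtype.ext (Subtype.ext (funext fun q => Quotient.inductionOn q fun _ => rfl))

/-- The kernel of a homomorphism is a congruence. -/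
theorem FDSHom.ker_map {δ β : Type} {k : δ → δ} {g : β → β} (φ : FDSHom k g) {x y : δ}
    (hxy : Setoid.ker φ.1 x y) : Setoid.ker φ.1 (k x) (k y) := by
  rw [Setoid.ker_def] at hxy ⊢
  rw [φ.2 x, φ.2 y, hxy]

/-- Homomorphisms are counted by their kernels. -/
theorem FDSHom.card_eq_sum_ker {δ β : Type} [Finite δ] [Finite β] [Fintype (Setoid δ)]
    (k : δ → δ) (g : β → β) :
    Nat.card (FDSHom k g) = ∑ s : Setoid δ, Nat.card {φ : FDSHom k g // Setoid.ker φ.1 = s} := by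
  rw [← Nat.card_sigma]
  exact Nat.card_congr (Equiv.sigmaFiberEquiv fun φ : FDSHom k g => Setoid.ker φ.1).symm

/-- Homomorphism counts determine embedding counts. -/
theorem FDSEmb.card_eq_of_card_hom_eq {β γ : Type} [Finite β] [Finite γ] {g : β → β} {h : γ → γ}
    (H : ∀ (δ : Type) [Finite δ] (k : δ → δ), Nat.card (FDSHom k g) = Nat.card (FDSHom k h))
    (δ : Type) [Finite δ] (k : δ → δ) : Nat.card (FDSEmb k g) = Nat.card (FDSEmb k h) := by
  classical
  induction hn : Nat.card δ using Nat.strong_induction_on generalizing δ with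
  | _ n ih =>
    have : Finite (Setoid δ) :=
      Finite.of_injective (fun s : Setoid δ => (s : δ → δ → Prop)) fun s t hst =>
        Setoid.ext fun x y => iff_of_eq (congrFun (congrFun hst x) y)
    have := Fintype.ofFinite (Setoid δ)
    have hsum := H δ k
    rw [FDSHom.card_eq_sum_ker, FDSHom.card_eq_sum_ker,
      ← Finset.add_sum_erase _ _ (Finset.mem_univ (⊥ : Setoid δ)),
      ← Finset.add_sum_erase _ _ (Finset.mem_univ (⊥ : Setoid δ))] at hsum
    have hrest : ∀ s ∈ Finset.univ.erase (⊥ : Setoid δ),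
        Nat.card {φ : FDSHom k g // Setoid.ker φ.1 = s} =
          Nat.card {φ : FDSHom k h // Setoid.ker φ.1 = s} := by
      intro s hs
      by_cases hk : ∀ x y, s x y → s (k x) (k y)
      · rw [Nat.card_congr (FDSHom.kerEquiv k g s hk), Nat.card_congr (FDSHom.kerEquiv k h s hk)]
        refine ih _ ?_ _ _ rfl
        rw [← hn]
        refine lt_of_le_of_ne (Nat.card_le_card_of_surjective _ Quotient.mk_surjective)
          fun hcard => Finset.ne_of_mem_erase hs ?_
        have hbij := (Nat.bijective_iff_surjective_and_card (Quotient.mk s)).2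
          ⟨Quotient.mk_surjective, hcard.symm⟩
        exact Setoid.ext fun x y =>
          ⟨fun hxy => hbij.1 (Quotient.sound hxy), fun hxy => hxy ▸ Setoid.refl' s x⟩
      · have : IsEmpty {φ : FDSHom k g // Setoid.ker φ.1 = s} :=
          ⟨fun φ => hk fun _ _ hxy => φ.2 ▸ φ.1.ker_map (φ.2.symm ▸ hxy)⟩
        have : IsEmpty {φ : FDSHom k h // Setoid.ker φ.1 = s} :=
          ⟨fun φ => hk fun _ _ hxy => φ.2 ▸ φ.1.ker_map (φ.2.symm ▸ hxy)⟩
        rw [Nat.card_of_isEmpty, Nat.card_of_isEmpty]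
    rw [Finset.sum_congr rfl hrest] at hsum
    simpa only [← Setoid.injective_iff_ker_bot] using Nat.add_right_cancel hsum

/-- Homomorphism counts determine a finite dynamical system up to isomorphism. -/
theorem FDSIso.of_card_hom_eq {β γ : Type} [Finite β] [Finite γ] {g : β → β} {h : γ → γ}
    (H : ∀ (δ : Type) [Finite δ] (k : δ → δ), Nat.card (FDSHom k g) = Nat.card (FDSHom k h)) :
    FDSIso g h := by
  have hg : Nonempty (FDSEmb g g) := ⟨⟨⟨id, fun _ => rfl⟩, Function.injective_id⟩⟩
  have hh : Nonempty (FDSEmb h h) := ⟨⟨⟨id, fun _ => rfl⟩, Function.injective_id⟩⟩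
  have hgh : 0 < Nat.card (FDSEmb g h) :=
    FDSEmb.card_eq_of_card_hom_eq H β g ▸ Nat.card_pos
  have hhg : 0 < Nat.card (FDSEmb h g) :=
    (FDSEmb.card_eq_of_card_hom_eq H γ h).symm ▸ Nat.card_pos
  obtain ⟨φ, hφ⟩ := (Nat.card_pos_iff.1 hgh).1
  obtain ⟨ψ, hψ⟩ := (Nat.card_pos_iff.1 hhg).1
  have hcard : Nat.card β = Nat.card γ :=
    le_antisymm (Nat.card_le_card_of_injective _ hφ) (Nat.card_le_card_of_injective _ hψ)
  exact ⟨Equiv.ofBijective φ.1 ((Nat.bijective_iff_injective_and_card _).2 ⟨hφ, hcard⟩), φ.2⟩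

/-- An FDS with a fixpoint is cancellative. -/
theorem fds_cancellative_of_fixpoint (α : Type) [Fintype α] (f : α → α)
    (hfix : ∃ a, f a = a) :
    ∀ (β γ : Type) [Fintype β] [Fintype γ] (g : β → β) (h : γ → γ),
      FDSIso (Prod.map f g) (Prod.map f h) → FDSIso g h := by
  obtain ⟨a, ha⟩ := hfix
  intro β γ _ _ g h H
  refine FDSIso.of_card_hom_eq fun δ _ k => ?_
  have : Nonempty (FDSHom k f) := ⟨⟨fun _ => a, fun _ => ha.symm⟩⟩
  have hprod := H.card_hom_eq k
  rw [Nat.card_congr (FDSHom.prodEquiv k f g), Nat.card_congr (FDSHom.prodEquiv k f h),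
    Nat.card_prod, Nat.card_prod] at hprod
  exact Nat.eq_of_mul_eq_mul_left Nat.card_pos hprod
end

section
/- Let f : α → α and b : β → β be connected FDSs on finite sets, and let g : γ → γ and h : δ → δ be FDSs on finite sets. If f × g is isomorphic to b and f × h is isomorphic to b, then g is isomorphic to h. -/
/-- An FDS is connected if its state set is nonempty and any two states have iterates
that meet (i.e. its functional graph is connected). -/
def FDSConnected {α : Type} (f : α → α) : Prop :=
  Nonempty α ∧ ∀ x y : α, ∃ m n : ℕ, f^[m] x = f^[n] y

open Function

section HomCounting

variable {Y γ δ : Type}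

/-- Morphisms whose kernel is a given invariant setoid are the injective morphisms out of the
quotient. -/
def semiconjKerEquiv {u : Y → Y} (g : γ → γ) (r : Setoid Y)
    (hr : ∀ x y, r x y → r (u x) (u y)) :
    {φ : {φ : Y → γ // Semiconj φ u g} // Setoid.ker φ.1 = r} ≃
      {φ : Quotient r → γ // Semiconj φ (Quotient.map u hr) g ∧ Injective φ} where
  toFun φ := ⟨Quotient.lift φ.1.1 fun x y hxy => by
      have : Setoid.ker φ.1.1 x y := by rw [φ.2]; exact hxy
      exact this, by
    constructor
    · rintro ⟨x⟩
      exact φ.1.2 x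
    · rintro ⟨x⟩ ⟨y⟩ hxy
      refine Quotient.sound ?_
      have : Setoid.ker φ.1.1 x y := hxy
      rw [φ.2] at this
      exact this⟩
  invFun φ := ⟨⟨fun y => φ.1 (Quotient.mk r y), fun y => φ.2.1 (Quotient.mk r y)⟩, by
    ext x y
    exact φ.2.2.eq_iff.trans Quotient.eq⟩
  left_inv _ := rfl
  right_inv φ := by
    ext ⟨x⟩
    rfl

/-- A morphism is an injective one exactly when its kernel is trivial. -/
def semiconjInjectiveEquiv (u : Y → Y) (g : γ → γ) :
    {φ : {φ : Y → γ // Semiconj φ u g} // Setoid.ker φ.1 = ⊥} ≃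
      {φ : Y → γ // Semiconj φ u g ∧ Injective φ} :=
  (Equiv.subtypeEquivRight fun _ => Setoid.injective_iff_ker_bot _ |>.symm).trans
    (Equiv.subtypeSubtypeEquivSubtypeInter _ (fun φ : Y → γ => Injective φ))

theorem finite_setoid (Y : Type) [Finite Y] : Finite (Setoid Y) :=
  Finite.of_injective (fun r : Setoid Y => (r : Y → Y → Prop)) fun r s h => by
    ext x y
    exact iff_of_eq (congrFun (congrFun h x) y)

theorem sum_card_semiconj_ker [Finite Y] [Finite γ] [Fintype (Setoid Y)]
    (u : Y → Y) (g : γ → γ) :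
    ∑ r : Setoid Y, Nat.card {φ : {φ : Y → γ // Semiconj φ u g} // Setoid.ker φ.1 = r} =
      Nat.card {φ : Y → γ // Semiconj φ u g} := by
  rw [← Nat.card_sigma]
  exact Nat.card_congr
    (Equiv.sigmaFiberEquiv fun φ : {φ : Y → γ // Semiconj φ u g} => Setoid.ker φ.1)

/-- Counts of all morphisms determine counts of injective morphisms. -/
theorem card_injective_semiconj_eq [Finite γ] [Finite δ] {g : γ → γ} {h : δ → δ}
    (H : ∀ (Y : Type) [Finite Y] (u : Y → Y),
      Nat.card {φ : Y → γ // Semiconj φ u g} = Nat.card {φ : Y → δ // Semiconj φ u h})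
    (n : ℕ) : ∀ (Y : Type) [Finite Y] (u : Y → Y), Nat.card Y = n →
      Nat.card {φ : Y → γ // Semiconj φ u g ∧ Injective φ} =
        Nat.card {φ : Y → δ // Semiconj φ u h ∧ Injective φ} := by
  classical
  induction n using Nat.strong_induction_on with
  | _ n ih =>
    intro Y _ u hn
    have := finite_setoid Y
    have := Fintype.ofFinite (Setoid Y)
    have key : ∀ r ∈ Finset.univ.erase (⊥ : Setoid Y),
        Nat.card {φ : {φ : Y → γ // Semiconj φ u g} // Setoid.ker φ.1 = r} =
          Nat.card {φ : {φ : Y → δ // Semiconj φ u h} // Setoid.ker φ.1 = r} := by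
      intro r hr
      by_cases hu : ∀ x y, r x y → r (u x) (u y)
      · rw [Nat.card_congr (semiconjKerEquiv g r hu), Nat.card_congr (semiconjKerEquiv h r hu)]
        refine ih _ ?_ (Quotient r) _ rfl
        rw [← hn]
        refine lt_of_le_of_ne (Nat.card_le_card_of_surjective _ Quotient.mk_surjective) ?_
        intro hcard
        refine Finset.ne_of_mem_erase hr ?_
        have hinj := (Quotient.mk_surjective (s := r)).bijective_of_nat_card_le hcard.ge |>.1
        ext x y
        exact Quotient.eq.symm.trans hinj.eq_iff
      · have aux : ∀ {ε : Type} (k : ε → ε),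
            IsEmpty {φ : {φ : Y → ε // Semiconj φ u k} // Setoid.ker φ.1 = r} := by
          refine fun k => ⟨fun φ => hu fun x y hxy => ?_⟩
          rw [← φ.2] at hxy ⊢
          change φ.1.1 (u x) = φ.1.1 (u y)
          rw [φ.1.2 x, φ.1.2 y]
          exact congrArg k hxy
        have := aux g
        have := aux h
        rw [Nat.card_of_isEmpty, Nat.card_of_isEmpty]
    have total := H Y u
    rw [← sum_card_semiconj_ker u g, ← sum_card_semiconj_ker u h,
      ← Finset.add_sum_erase _ _ (Finset.mem_univ (⊥ : Setoid Y)),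
      ← Finset.add_sum_erase _ _ (Finset.mem_univ (⊥ : Setoid Y)),
      Finset.sum_congr rfl key] at total
    rw [← Nat.card_congr (semiconjInjectiveEquiv u g),
      ← Nat.card_congr (semiconjInjectiveEquiv u h)]
    exact Nat.add_right_cancel total

/-- Lovász's theorem for finite dynamical systems: morphism counts determine the system. -/
theorem fdsIso_of_card_semiconj_eq [Finite γ] [Finite δ] {g : γ → γ} {h : δ → δ}
    (H : ∀ (Y : Type) [Finite Y] (u : Y → Y),
      Nat.card {φ : Y → γ // Semiconj φ u g} = Nat.card {φ : Y → δ // Semiconj φ u h}) :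
    FDSIso g h := by
  have hgh := card_injective_semiconj_eq H _ γ g rfl
  have hhg := card_injective_semiconj_eq H _ δ h rfl
  have : Nonempty {φ : γ → γ // Semiconj φ g g ∧ Injective φ} :=
    ⟨⟨id, Semiconj.id_left, injective_id⟩⟩
  have : Nonempty {φ : δ → δ // Semiconj φ h h ∧ Injective φ} :=
    ⟨⟨id, Semiconj.id_left, injective_id⟩⟩
  obtain ⟨⟨φ, hφ, hφi⟩⟩ := (Nat.card_pos_iff.1 (hgh ▸ Nat.card_pos)).1
  obtain ⟨⟨ψ, -, hψi⟩⟩ := (Nat.card_pos_iff.1 (hhg.symm ▸ Nat.card_pos)).1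
  exact ⟨Equiv.ofBijective φ
    (hφi.bijective_of_nat_card_le (Nat.card_le_card_of_injective ψ hψi)), hφ⟩

end HomCounting

section Periodic

variable {α γ δ Y : Type}

theorem FDSConnected.exists_iterate_eq {f : α → α} (hf : FDSConnected f) {x y : α}
    (hx : x ∈ periodicPts f) : ∃ i, f^[i] y = x := by
  obtain ⟨m, n, hmn⟩ := hf.2 x y
  obtain ⟨k, hk, hkx⟩ := hx
  refine ⟨(k * m - m) + n, ?_⟩
  rw [iterate_add_apply, ← hmn, ← iterate_add_apply,
    Nat.sub_add_cancel (Nat.le_mul_of_pos_left m hk)]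
  exact hkx.mul_const m

theorem FDSConnected.minimalPeriod_eq {f : α → α} (hf : FDSConnected f) {x y : α}
    (hx : x ∈ periodicPts f) (hy : y ∈ periodicPts f) :
    minimalPeriod f x = minimalPeriod f y := by
  obtain ⟨i, rfl⟩ := hf.exists_iterate_eq (y := y) hx
  exact minimalPeriod_apply_iterate hy i

theorem FDSConnected.of_iso {f : α → α} {g : γ → γ} (hg : FDSConnected g) (e : α ≃ γ)
    (he : Semiconj e f g) : FDSConnected f := by
  refine ⟨hg.1.map e.symm, fun x y => ?_⟩
  obtain ⟨m, n, hmn⟩ := hg.2 (e x) (e y)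
  refine ⟨m, n, e.injective ?_⟩
  rw [(he.iterate_right m).eq, (he.iterate_right n).eq, hmn]

theorem mem_periodicPts_prodMap {f : α → α} {g : γ → γ} {x : α × γ} :
    x ∈ periodicPts (Prod.map f g) ↔ x.1 ∈ periodicPts f ∧ x.2 ∈ periodicPts g := by
  constructor
  · rintro ⟨n, hn, hx⟩
    rw [isPeriodicPt_prodMap] at hx
    exact ⟨⟨n, hn, hx.1⟩, ⟨n, hn, hx.2⟩⟩
  · rintro ⟨⟨m, hm, hmx⟩, ⟨n, hn, hnx⟩⟩
    exact ⟨m * n, Nat.mul_pos hm hn,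
      (isPeriodicPt_prodMap x).2 ⟨hmx.mul_const n, hnx.const_mul m⟩⟩

theorem coprime_minimalPeriod_of_connected_prodMap {f : α → α} {g : γ → γ}
    (H : FDSConnected (Prod.map f g)) {a : α} {c : γ}
    (ha : a ∈ periodicPts f) (hc : c ∈ periodicPts g) :
    (minimalPeriod f a).Coprime (minimalPeriod g c) := by
  obtain ⟨i, hi⟩ := H.exists_iterate_eq (x := (a, c)) (y := (f a, c))
    (mem_periodicPts_prodMap.2 ⟨ha, hc⟩)
  rw [Prod.map_iterate, Prod.map_apply, Prod.mk.injEq, ← iterate_succ_apply] at hi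
  have h₁ : minimalPeriod f a ∣ i + 1 := IsPeriodicPt.minimalPeriod_dvd hi.1
  have h₂ : minimalPeriod g c ∣ i := IsPeriodicPt.minimalPeriod_dvd hi.2
  exact Nat.Coprime.of_dvd h₁ h₂ (by simp)

theorem minimalPeriod_eq_of_injective_semiconj {f : α → α} {g : γ → γ} {e : α → γ}
    (hi : Injective e) (he : Semiconj e f g) (x : α) :
    minimalPeriod g (e x) = minimalPeriod f x := by
  refine minimalPeriod_eq_minimalPeriod_iff.2 fun n => ?_
  rw [IsPeriodicPt, IsFixedPt, ← (he.iterate_right n).eq, hi.eq_iff]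
  rfl

section Iso

variable {f : α → α} {g : γ → γ} {h : δ → δ} {e : α × γ → α × δ} {a a' : α} {c c' : γ}

theorem semiconj_periodic (he : Semiconj e (Prod.map f g) (Prod.map f h))
    (ha : a ∈ periodicPts f) (hc : c ∈ periodicPts g) :
    (e (a, c)).1 ∈ periodicPts f ∧ (e (a, c)).2 ∈ periodicPts h :=
  mem_periodicPts_prodMap.1
    (he.mapsTo_periodicPts (mem_periodicPts_prodMap.2 ⟨ha, hc⟩))

theorem fst_eq_of_periodic (hf : FDSConnected f) (hfg : FDSConnected (Prod.map f g))
    (he : Semiconj e (Prod.map f g) (Prod.map f h))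
    (ha : a ∈ periodicPts f) (hc : c ∈ periodicPts g) (hc' : c' ∈ periodicPts g) :
    (e (a, c')).1 = (e (a, c)).1 := by
  obtain ⟨i, hi⟩ := hfg.exists_iterate_eq (x := (a, c')) (y := (a, c))
    (mem_periodicPts_prodMap.2 ⟨ha, hc'⟩)
  have hai : f^[i] a = a := by
    simpa [Prod.map_iterate] using congrArg Prod.fst hi
  rw [← hi, (he.iterate_right i).eq, Prod.map_iterate, Prod.map_fst]
  refine isPeriodicPt_iff_minimalPeriod_dvd.2 ?_
  rw [hf.minimalPeriod_eq (semiconj_periodic he ha hc).1 ha]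
  exact IsPeriodicPt.minimalPeriod_dvd hai

theorem snd_eq_of_periodic (hf : FDSConnected f) (hfg : FDSConnected (Prod.map f g))
    (hfh : FDSConnected (Prod.map f h)) (hei : Injective e)
    (he : Semiconj e (Prod.map f g) (Prod.map f h))
    (ha : a ∈ periodicPts f) (ha' : a' ∈ periodicPts f) (hc : c ∈ periodicPts g) :
    (e (a', c)).2 = (e (a, c)).2 := by
  obtain ⟨i, hi⟩ := hfg.exists_iterate_eq (x := (a', c)) (y := (a, c))
    (mem_periodicPts_prodMap.2 ⟨ha', hc⟩)
  have hci : g^[i] c = c := by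
    simpa [Prod.map_iterate] using congrArg Prod.snd hi
  rw [← hi, (he.iterate_right i).eq, Prod.map_iterate, Prod.map_snd]
  refine isPeriodicPt_iff_minimalPeriod_dvd.2 ?_
  have hmem := semiconj_periodic he ha hc
  have hper := minimalPeriod_eq_of_injective_semiconj hei he (a, c)
  rw [minimalPeriod_prodMap, minimalPeriod_prodMap,
    (coprime_minimalPeriod_of_connected_prodMap hfh hmem.1 hmem.2).lcm_eq_mul,
    (coprime_minimalPeriod_of_connected_prodMap hfg ha hc).lcm_eq_mul,
    hf.minimalPeriod_eq hmem.1 ha] at hper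
  rw [Nat.eq_of_mul_eq_mul_left (minimalPeriod_pos_of_mem_periodicPts ha) hper]
  exact IsPeriodicPt.minimalPeriod_dvd hci

end Iso

/-- Maps commuting with the dynamics at the transient states, and sending all recurrent states to
one and the same recurrent state. -/
def TransientHom (u : Y → Y) (f : α → α) (φ : Y → α) : Prop :=
  (∀ y ∉ periodicPts u, φ (u y) = f (φ y)) ∧
    ∃ a ∈ periodicPts f, ∀ y ∈ periodicPts u, φ y = a

theorem exists_iterate_mem_periodicPts [Finite Y] (u : Y → Y) (y : Y) :
    ∃ n, u^[n] y ∈ periodicPts u := by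
  obtain ⟨m, n, hne, hmn⟩ := Finite.exists_ne_map_eq_of_infinite fun n => u^[n] y
  wlog hlt : m < n generalizing m n
  · exact this n m hne.symm hmn.symm (lt_of_le_of_ne (not_lt.1 hlt) hne.symm)
  refine ⟨m, n - m, Nat.sub_pos_of_lt hlt, ?_⟩
  rw [IsPeriodicPt, IsFixedPt, ← iterate_add_apply, Nat.sub_add_cancel hlt.le]
  exact hmn.symm

theorem exists_transientHom [Finite Y] [Finite α] [Nonempty α] (u : Y → Y) (f : α → α) :
    ∃ φ, TransientHom u f φ := by
  classical
  obtain ⟨n, ha⟩ := exists_iterate_mem_periodicPts f (Classical.arbitrary α)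
  generalize f^[n] (Classical.arbitrary α) = a at ha
  have hs : ∀ x : periodicPts f, ∃ y : periodicPts f, f y = x := fun x => by
    obtain ⟨y, hy, hyx⟩ := (bijOn_periodicPts f).surjOn x.2
    exact ⟨⟨y, hy⟩, hyx⟩
  choose s hs using hs
  have hex := exists_iterate_mem_periodicPts u
  refine ⟨fun y => s^[Nat.find (hex y)] ⟨a, ha⟩, fun y hy => ?_, a, ha, fun y hy => ?_⟩
  · have hsucc : Nat.find (hex y) = Nat.find (hex (u y)) + 1 :=
      Nat.find_comp_succ (hex y) (hex (u y)) hy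
    dsimp only
    rw [hsucc, iterate_succ_apply', hs]
  · have hzero : Nat.find (hex y) = 0 := (Nat.find_eq_zero _).2 hy
    simp [hzero]

theorem Function.Semiconj.mem_periodicPts {u : Y → Y} {g : γ → γ} {φ : Y → γ}
    (hφ : Semiconj φ u g) {y : Y} (hy : y ∈ periodicPts u) : φ y ∈ periodicPts g :=
  hφ.mapsTo_periodicPts hy

theorem transientHom_semiconj_comp {f : α → α} {g : γ → γ} {h : δ → δ} {u : Y → Y}
    {e : α × γ → α × δ} (hf : FDSConnected f) (hfg : FDSConnected (Prod.map f g))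
    (hfh : FDSConnected (Prod.map f h)) (hei : Injective e)
    (he : Semiconj e (Prod.map f g) (Prod.map f h)) {φ : Y → α} {ψ : Y → γ}
    (hφ : TransientHom u f φ) (hψ : Semiconj ψ u g) :
    TransientHom u f (fun y => (e (φ y, ψ y)).1) ∧
      Semiconj (fun y => (e (φ y, ψ y)).2) u h := by
  obtain ⟨htr, a, ha, hφa⟩ := hφ
  have transient : ∀ y ∉ periodicPts u,
      e (φ (u y), ψ (u y)) = Prod.map f h (e (φ y, ψ y)) := fun y hy => by
    rw [htr y hy, hψ.eq, ← he.eq]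
    rfl
  refine ⟨⟨fun y hy => congrArg Prod.fst (transient y hy), ?_⟩, fun y => ?_⟩
  · by_cases hne : ∃ y₀, y₀ ∈ periodicPts u
    · obtain ⟨y₀, hy₀⟩ := hne
      refine ⟨(e (a, ψ y₀)).1, (semiconj_periodic he ha (hψ.mem_periodicPts hy₀)).1,
        fun y hy => ?_⟩
      dsimp only
      rw [hφa y hy]
      exact fst_eq_of_periodic hf hfg he ha (hψ.mem_periodicPts hy₀) (hψ.mem_periodicPts hy)
    · exact ⟨a, ha, fun y hy => (hne ⟨y, hy⟩).elim⟩
  · by_cases hy : y ∈ periodicPts u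
    · have huy : u y ∈ periodicPts u := (bijOn_periodicPts u).mapsTo hy
      have hfa : f a ∈ periodicPts f := (bijOn_periodicPts f).mapsTo ha
      dsimp only
      rw [hφa y hy, hφa _ huy, snd_eq_of_periodic hf hfg hfh hei he hfa ha
        (hψ.mem_periodicPts huy), hψ.eq]
      exact congrArg Prod.snd (he.eq (a, ψ y))
    · exact congrArg Prod.snd (transient y hy)

/-- An isomorphism of connected products transports pairs of a transient morphism to the common
factor and a morphism to the other factor. -/
def transientHomProdEquiv {f : α → α} {g : γ → γ} {h : δ → δ} (u : Y → Y)
    (e : α × γ ≃ α × δ) (hf : FDSConnected f) (hfg : FDSConnected (Prod.map f g))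
    (hfh : FDSConnected (Prod.map f h)) (he : Semiconj e (Prod.map f g) (Prod.map f h)) :
    {φ : Y → α // TransientHom u f φ} × {ψ : Y → γ // Semiconj ψ u g} ≃
      {φ : Y → α // TransientHom u f φ} × {ψ : Y → δ // Semiconj ψ u h} where
  toFun p :=
    have hp := transientHom_semiconj_comp hf hfg hfh e.injective he p.1.2 p.2.2
    ⟨⟨_, hp.1⟩, ⟨_, hp.2⟩⟩
  invFun p :=
    have hp := transientHom_semiconj_comp hf hfh hfg e.symm.injective
      (he.inverse_left e.left_inv e.right_inv) p.1.2 p.2.2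
    ⟨⟨_, hp.1⟩, ⟨_, hp.2⟩⟩
  left_inv p := by simp
  right_inv p := by simp

end Periodic

/-- If `f` and `b` are connected and `f × g ≅ b ≅ f × h`, then `g ≅ h`. -/
theorem connected_quotient_unique (α β γ δ : Type)
    [Fintype α] [Fintype β] [Fintype γ] [Fintype δ]
    (f : α → α) (b : β → β) (g : γ → γ) (h : δ → δ)
    (hf : FDSConnected f) (hb : FDSConnected b)
    (h₁ : FDSIso (Prod.map f g) b) (h₂ : FDSIso (Prod.map f h) b) :
    FDSIso g h := by
  obtain ⟨e₁, he₁⟩ := h₁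
  obtain ⟨e₂, he₂⟩ := h₂
  have hfg : FDSConnected (Prod.map f g) := hb.of_iso e₁ he₁
  have hfh : FDSConnected (Prod.map f h) := hb.of_iso e₂ he₂
  have he : Semiconj (e₁.trans e₂.symm) (Prod.map f g) (Prod.map f h) := fun x => by
    refine e₂.injective ?_
    simp [he₁, he₂]
  refine fdsIso_of_card_semiconj_eq fun Y _ u => ?_
  have := hf.1
  have : Nonempty {φ : Y → α // TransientHom u f φ} :=
    nonempty_subtype.2 (exists_transientHom u f)
  have hcard := Nat.card_congr (transientHomProdEquiv u (e₁.trans e₂.symm) hf hfg hfh he)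
  rw [Nat.card_prod, Nat.card_prod] at hcard
  exact Nat.eq_of_mul_eq_mul_left Nat.card_pos hcard
end
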